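/- Let A be a real n×n matrix with constant row sums and let p ∈ [1,∞]. Then the sequence k ↦ (τ_p(A^{2^k}))^{1/2^k} is monotone non-increasing; that is, for every k ≥ 0, (τ_p(A^{2^{k+1}}))^{1/2^{k+1}} ≤ (τ_p(A^{2^k}))^{1/2^k}. -/

import Mathlib

open Matrix Polynomial Filter
open scoped ENNReal

/-- The `l_p` norm of a vector in `ℝⁿ`, for `p ∈ [0,∞]`. -/
noncomputable def lpNorm (p : ℝ≥0∞) {n : ℕ} (x : Fin n → ℝ) : ℝ :=
  ‖(WithLp.equiv p (Fin n → ℝ)).symm x‖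

/-- The vector-norm based ergodicity coefficient `τ_p(A)`. -/
noncomputable def tau (p : ℝ≥0∞) {n : ℕ} (A : Matrix (Fin n) (Fin n) ℝ) : ℝ :=
  sSup {y : ℝ | ∃ x : Fin n → ℝ, (∑ i, x i) = 0 ∧ lpNorm p x = 1 ∧ y = lpNorm p (Aᵀ *ᵥ x)}

/-- The all-ones matrix `J`. -/
def allOnes (n : ℕ) : Matrix (Fin n) (Fin n) ℝ := Matrix.of fun _ _ => 1

theorem lpNorm_nonneg {p : ℝ≥0∞} (hp : 1 ≤ p) {n : ℕ} (x : Fin n → ℝ) : 0 ≤ lpNorm p x := by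
  have : Fact (1 ≤ p) := ⟨hp⟩
  exact norm_nonneg (WithLp.toLp p x)

theorem lpNorm_zero {p : ℝ≥0∞} (hp : 1 ≤ p) {n : ℕ} : lpNorm p (0 : Fin n → ℝ) = 0 := by
  have : Fact (1 ≤ p) := ⟨hp⟩
  exact norm_zero (E := PiLp p fun _ : Fin n => ℝ)

theorem lpNorm_eq_zero {p : ℝ≥0∞} (hp : 1 ≤ p) {n : ℕ} {x : Fin n → ℝ} (hx : lpNorm p x = 0) :
    x = 0 := by
  have : Fact (1 ≤ p) := ⟨hp⟩
  have h : WithLp.toLp p x = 0 := norm_eq_zero.1 hx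
  exact congrArg WithLp.ofLp h

theorem lpNorm_smul {p : ℝ≥0∞} (hp : 1 ≤ p) {n : ℕ} (a : ℝ) (x : Fin n → ℝ) :
    lpNorm p (a • x) = |a| * lpNorm p x := by
  have : Fact (1 ≤ p) := ⟨hp⟩
  exact norm_smul a (WithLp.toLp p x)

theorem exists_lpNorm_mulVec_le {p : ℝ≥0∞} (hp : 1 ≤ p) {n : ℕ} (M : Matrix (Fin n) (Fin n) ℝ) :
    ∃ C : ℝ, ∀ x : Fin n → ℝ, lpNorm p (M *ᵥ x) ≤ C * lpNorm p x := by
  have : Fact (1 ≤ p) := ⟨hp⟩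
  let e := WithLp.linearEquiv p ℝ (Fin n → ℝ)
  let L : PiLp p (fun _ : Fin n => ℝ) →ₗ[ℝ] PiLp p (fun _ : Fin n => ℝ) :=
    e.symm.toLinearMap ∘ₗ M.mulVecLin ∘ₗ e.toLinearMap
  exact ⟨‖L.toContinuousLinearMap‖, fun x => L.toContinuousLinearMap.le_opNorm (WithLp.toLp p x)⟩

theorem tau_nonneg {p : ℝ≥0∞} (hp : 1 ≤ p) {n : ℕ} (A : Matrix (Fin n) (Fin n) ℝ) :
    0 ≤ tau p A := by
  refine Real.sSup_nonneg ?_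
  rintro y ⟨x, -, -, rfl⟩
  exact lpNorm_nonneg hp _

theorem lpNorm_transpose_mulVec_le_tau_mul {p : ℝ≥0∞} (hp : 1 ≤ p) {n : ℕ}
    (A : Matrix (Fin n) (Fin n) ℝ) {x : Fin n → ℝ} (hx : ∑ i, x i = 0) :
    lpNorm p (Aᵀ *ᵥ x) ≤ tau p A * lpNorm p x := by
  obtain ⟨C, hC⟩ := exists_lpNorm_mulVec_le hp Aᵀ
  rcases (lpNorm_nonneg hp x).eq_or_lt with h0 | h0
  · rw [lpNorm_eq_zero hp h0.symm, mulVec_zero, lpNorm_zero hp, mul_zero]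
  · have hle : lpNorm p (Aᵀ *ᵥ ((lpNorm p x)⁻¹ • x)) ≤ tau p A := by
      refine le_csSup ⟨C, ?_⟩ ⟨(lpNorm p x)⁻¹ • x, ?_, ?_, rfl⟩
      · rintro y ⟨z, -, hz, rfl⟩
        simpa [hz] using hC z
      · simp [← Finset.mul_sum, hx]
      · rw [lpNorm_smul hp, abs_of_pos (inv_pos.2 h0), inv_mul_cancel₀ h0.ne']
    rwa [mulVec_smul, lpNorm_smul hp, abs_of_pos (inv_pos.2 h0), inv_mul_le_iff₀ h0,
      mul_comm] at hle

/-- Transposes of e-matrices preserve the hyperplane of vectors with zero sum. -/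
theorem sum_transpose_mulVec_eq_zero {n : ℕ} {A : Matrix (Fin n) (Fin n) ℝ} {c : ℝ}
    (hrow : ∀ i, ∑ j, A i j = c) {x : Fin n → ℝ} (hx : ∑ i, x i = 0) :
    ∑ i, (Aᵀ *ᵥ x) i = 0 := by
  simp only [mulVec, dotProduct, transpose_apply]
  rw [Finset.sum_comm]
  simp only [← Finset.sum_mul, hrow, ← Finset.mul_sum, hx, mul_zero]

theorem sum_pow_apply {n : ℕ} {A : Matrix (Fin n) (Fin n) ℝ} {c : ℝ}
    (hrow : ∀ i, ∑ j, A i j = c) (m : ℕ) (i : Fin n) : ∑ j, (A ^ m) i j = c ^ m := by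
  induction m with
  | zero => simp [Matrix.one_apply]
  | succ m ih =>
    simp only [pow_succ, Matrix.mul_apply]
    rw [Finset.sum_comm]
    simp only [← Finset.mul_sum, hrow, ← Finset.sum_mul, ih]

/-- Submultiplicativity of the ergodicity coefficient. -/
theorem tau_mul_le {p : ℝ≥0∞} (hp : 1 ≤ p) {n : ℕ} {A : Matrix (Fin n) (Fin n) ℝ} {c : ℝ}
    (hrow : ∀ i, ∑ j, A i j = c) (B : Matrix (Fin n) (Fin n) ℝ) :
    tau p (A * B) ≤ tau p A * tau p B := by
  refine Real.sSup_le ?_ (mul_nonneg (tau_nonneg hp A) (tau_nonneg hp B))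
  rintro y ⟨x, hx, hx1, rfl⟩
  rw [transpose_mul, ← mulVec_mulVec]
  calc lpNorm p (Bᵀ *ᵥ (Aᵀ *ᵥ x)) ≤ tau p B * lpNorm p (Aᵀ *ᵥ x) :=
        lpNorm_transpose_mulVec_le_tau_mul hp B (sum_transpose_mulVec_eq_zero hrow hx)
    _ ≤ tau p B * (tau p A * lpNorm p x) :=
        mul_le_mul_of_nonneg_left (lpNorm_transpose_mulVec_le_tau_mul hp A hx) (tau_nonneg hp B)
    _ = tau p A * tau p B := by rw [hx1]; ring

/-- The sequence `τ_p(A^(2^k))^(1/2^k)` is monotone non-increasing for every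
e-matrix A (Corollary 2.22). -/
theorem tau_pow_two_pow_antitone {n : ℕ} (A : Matrix (Fin n) (Fin n) ℝ) (c : ℝ)
    (hrow : ∀ i, ∑ j, A i j = c) (p : ℝ≥0∞) (hp : 1 ≤ p) (k : ℕ) :
    tau p (A ^ 2 ^ (k + 1)) ^ (1 / (2 ^ (k + 1) : ℝ)) ≤
      tau p (A ^ 2 ^ k) ^ (1 / (2 ^ k : ℝ)) := by
  have h0 := tau_nonneg hp (A ^ 2 ^ k)
  have hle : tau p (A ^ 2 ^ (k + 1)) ≤ tau p (A ^ 2 ^ k) ^ (2 : ℝ) := by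
    rw [Real.rpow_two, pow_succ 2 k, mul_two, pow_add, sq]
    exact tau_mul_le hp (sum_pow_apply hrow _) _
  calc _ ≤ (tau p (A ^ 2 ^ k) ^ (2 : ℝ)) ^ (1 / (2 ^ (k + 1) : ℝ)) :=
        Real.rpow_le_rpow (tau_nonneg hp _) hle (by positivity)
    _ = tau p (A ^ 2 ^ k) ^ (1 / (2 ^ k : ℝ)) := by
        rw [← Real.rpow_mul h0]
        congr 1
        field_simp
        ring
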